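/- (Gallai–Edmonds, part (d)) Let G be a finite simple graph, let D(G) be the set of vertices v of G such that some maximum matching of G does not cover v, let A(G) be the set of vertices in V(G) \ D(G) adjacent to at least one vertex of D(G), and let C(G) = V(G) \ (D(G) ∪ A(G)). Then every maximum matching M of G contains a near-perfect matching of each connected component of the subgraph induced by D(G), contains a perfect matching of the subgraph induced by C(G), and matches every vertex of A(G) to vertices lying in pairwise distinct connected components of the subgraph induced by D(G). -/

import Mathlib

/-- `s` is a matching of the graph `G`: a set of pairwise disjoint edges of `G`. -/
def IsMatchingFinset {V : Type*} (G : SimpleGraph V) (s : Finset (Sym2 V)) : Prop :=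
  (∀ e ∈ s, e ∈ G.edgeSet) ∧ (s : Set (Sym2 V)).Pairwise fun e f => ∀ v, v ∈ e → v ∉ f

/-- `s` is a maximum matching of `G`: a matching of maximum cardinality. -/
def IsMaximumMatchingFinset {V : Type*} (G : SimpleGraph V) (s : Finset (Sym2 V)) : Prop :=
  IsMatchingFinset G s ∧ ∀ t : Finset (Sym2 V), IsMatchingFinset G t → t.card ≤ s.card

/-- `D(G)`: the set of vertices missed by at least one maximum matching of `G`. -/
def gallaiD {V : Type*} (G : SimpleGraph V) : Set V :=
  {v | ∃ s : Finset (Sym2 V), IsMaximumMatchingFinset G s ∧ ∀ e ∈ s, v ∉ e}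

/-- `A(G)`: the set of vertices outside `D(G)` adjacent to at least one vertex of `D(G)`. -/
def gallaiA {V : Type*} (G : SimpleGraph V) : Set V :=
  {v | v ∉ gallaiD G ∧ ∃ u ∈ gallaiD G, G.Adj v u}

/-- `C(G) = V(G) \ (D(G) ∪ A(G))`. -/
def gallaiC {V : Type*} (G : SimpleGraph V) : Set V :=
  {v | v ∉ gallaiD G ∧ v ∉ gallaiA G}

/-- The support of a connected component of the induced subgraph on `D(G)`,
viewed as a set of vertices of `G`. -/
def compSupp {V : Type*} (G : SimpleGraph V)
    (c : (G.induce (gallaiD G)).ConnectedComponent) : Set V :=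
  Subtype.val '' c.supp

/-- No edge of `M` has `v` as an endpoint. -/
def Misses {V : Type*} (M : Finset (Sym2 V)) (v : V) : Prop := ∀ e ∈ M, v ∉ e

/-- `M` is a largest matching among those missing every vertex of `S`. -/
def IsMaximumAvoiding {V : Type*} (G : SimpleGraph V) (S : Finset V) (M : Finset (Sym2 V)) : Prop :=
  IsMatchingFinset G M ∧ (∀ v ∈ S, Misses M v) ∧
    ∀ T, IsMatchingFinset G T → (∀ v ∈ S, Misses T v) → T.card ≤ M.card

namespace IsMatchingFinset

variable {V : Type*} {G : SimpleGraph V} {M N : Finset (Sym2 V)}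

lemma eq_of_mem (hM : IsMatchingFinset G M) {e f : Sym2 V} {v : V} (he : e ∈ M) (hf : f ∈ M)
    (hve : v ∈ e) (hvf : v ∈ f) : e = f := by
  by_contra hne
  exact hM.2 he hf hne v hve hvf

lemma adj (hM : IsMatchingFinset G M) {u v : V} (h : s(u, v) ∈ M) : G.Adj u v := hM.1 _ h

lemma subset (hM : IsMatchingFinset G M) (h : N ⊆ M) : IsMatchingFinset G N :=
  ⟨fun e he => hM.1 e (h he), hM.2.mono (by exact_mod_cast h)⟩

end IsMatchingFinset

lemma Misses.subset {V : Type*} {M N : Finset (Sym2 V)} {v : V} (hM : Misses M v) (h : N ⊆ M) :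
    Misses N v :=
  fun e he => hM e (h he)

lemma exists_mem_of_not_misses {V : Type*} {M : Finset (Sym2 V)} {v : V} (h : ¬ Misses M v) :
    ∃ w, s(v, w) ∈ M := by
  simp only [Misses, not_forall, not_not] at h
  obtain ⟨e, he, hv⟩ := h
  obtain ⟨w, rfl⟩ := hv
  exact ⟨w, he⟩

open scoped Classical in
lemma IsMatchingFinset.insert {V : Type*} {G : SimpleGraph V} {N : Finset (Sym2 V)}
    (hN : IsMatchingFinset G N) {x y : V} (hxy : G.Adj x y) (hx : Misses N x) (hy : Misses N y) :
    IsMatchingFinset G (insert s(x, y) N) ∧ (insert s(x, y) N).card = N.card + 1 := by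
  refine ⟨⟨?_, ?_⟩, Finset.card_insert_of_notMem fun h => hx _ h (Sym2.mem_mk_left x y)⟩
  · intro e he
    rcases Finset.mem_insert.1 he with rfl | he
    exacts [hxy, hN.1 e he]
  · intro e he f hf hne v hve hvf
    rw [Finset.mem_coe, Finset.mem_insert] at he hf
    rcases he with rfl | he <;> rcases hf with rfl | hf
    · exact hne rfl
    · rcases Sym2.mem_iff.1 hve with rfl | rfl
      exacts [hx _ hf hvf, hy _ hf hvf]
    · rcases Sym2.mem_iff.1 hvf with rfl | rfl
      exacts [hx _ he hve, hy _ he hve]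
    · exact hne (hN.eq_of_mem he hf hve hvf)

open scoped Classical in
lemma Misses.insert {V : Type*} {N : Finset (Sym2 V)} {x y v : V} (hv : Misses N v) (hx : v ≠ x)
    (hy : v ≠ y) : Misses (insert s(x, y) N) v := by
  intro e he hve
  rcases Finset.mem_insert.1 he with rfl | he
  · rcases Sym2.mem_iff.1 hve with h | h
    exacts [hx h, hy h]
  · exact hv e he hve

open scoped Classical in
/-- Pulling a matching `N` towards a matching `M` at a vertex covered by `M` only. -/
lemma IsMatchingFinset.exists_exchange {V : Type*} {G : SimpleGraph V} {M N : Finset (Sym2 V)}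
    (hM : IsMatchingFinset G M) (hN : IsMatchingFinset G N) {x : V} (hxM : ¬ Misses M x)
    (hxN : Misses N x) :
    ∃ y, s(x, y) ∈ M ∧ (Misses N y ∨ ∃ N', IsMatchingFinset G N' ∧ N'.card = N.card ∧
      (∀ v, v ≠ x → Misses N v → Misses N' v) ∧ (M ∩ N).card < (M ∩ N').card) := by
  obtain ⟨y, hy⟩ := exists_mem_of_not_misses hxM
  refine ⟨y, hy, or_iff_not_imp_left.2 fun hyN => ?_⟩
  obtain ⟨z, hz⟩ := exists_mem_of_not_misses hyN
  have hsub : N.erase s(y, z) ⊆ N := Finset.erase_subset _ _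
  have hyE : Misses (N.erase s(y, z)) y := fun e he hye =>
    (Finset.mem_erase.1 he).1
      (hN.eq_of_mem (hsub he) hz hye (Sym2.mem_mk_left y z))
  obtain ⟨hmatch, hcard⟩ := (hN.subset hsub).insert (hM.adj hy) (hxN.subset hsub) hyE
  refine ⟨_, hmatch, ?_, ?_, ?_⟩
  · rw [hcard, Finset.card_erase_add_one hz]
  · intro v hvx hv
    refine (hv.subset hsub).insert hvx ?_
    rintro rfl
    exact hyN hv
  · refine Finset.card_lt_card (Finset.ssubset_iff_subset_ne.2 ⟨?_, ?_⟩)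
    · intro e he
      obtain ⟨heM, heN⟩ := Finset.mem_inter.1 he
      refine Finset.mem_inter.2 ⟨heM, Finset.mem_insert_of_mem (Finset.mem_erase.2 ⟨?_, heN⟩)⟩
      rintro rfl
      have := hM.eq_of_mem hy heM (Sym2.mem_mk_right x y) (Sym2.mem_mk_left y z)
      exact hxN _ heN (this ▸ Sym2.mem_mk_left x y)
    · intro h
      have hmem : s(x, y) ∈ M ∩ N := by
        rw [h]
        exact Finset.mem_inter.2 ⟨hy, Finset.mem_insert_self _ _⟩
      exact hxN _ (Finset.mem_inter.1 hmem).2 (Sym2.mem_mk_left x y)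

lemma not_of_exists_inter_card_lt {α : Type*} [DecidableEq α] (M : Finset α) {P : Finset α → Prop}
    (h : ∀ N, P N → ∃ N', P N' ∧ (M ∩ N).card < (M ∩ N').card) (N : Finset α) : ¬ P N := by
  induction hn : M.card - (M ∩ N).card using Nat.strong_induction_on generalizing N with
  | _ n ih =>
    intro hN
    obtain ⟨N', hN', hlt⟩ := h N hN
    have := Finset.card_le_card (Finset.inter_subset_left (s₁ := M) (s₂ := N'))
    exact ih _ (by omega) N' rfl hN'

open scoped Classical in
lemma IsMatchingFinset.card_covered {V : Type*} [Fintype V] {G : SimpleGraph V}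
    {M : Finset (Sym2 V)} (hM : IsMatchingFinset G M) :
    (Finset.univ.filter fun v => ¬ Misses M v).card = 2 * M.card := by
  have h : (Finset.univ.filter fun v => ¬ Misses M v) = M.biUnion Sym2.toFinset := by
    ext v
    simp [Misses]
  rw [h, Finset.card_biUnion]
  · rw [Finset.sum_congr rfl fun e he =>
      Sym2.card_toFinset_of_not_isDiag e (G.not_isDiag_of_mem_edgeSet (hM.1 e he))]
    simp [mul_comm]
  · intro e he f hf hne
    rw [Function.onFun, Finset.disjoint_left]
    intro v hv hv'
    exact hM.2 he hf hne v (Sym2.mem_toFinset.1 hv) (Sym2.mem_toFinset.1 hv')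

open scoped Classical in
lemma IsMatchingFinset.card_missed {V : Type*} [Fintype V] {G : SimpleGraph V}
    {M : Finset (Sym2 V)} (hM : IsMatchingFinset G M) :
    (Finset.univ.filter (Misses M)).card + 2 * M.card = Fintype.card V := by
  rw [← hM.card_covered, Finset.card_filter_add_card_filter_not, Finset.card_univ]

/-- Among the vertices missed by some maximum avoiding matching, being missed simultaneously
is co-transitive (Gallai's lemma). -/
lemma IsMaximumAvoiding.exists_misses_and_misses {V : Type*} [Fintype V] {G : SimpleGraph V}
    {S : Finset V} {M : Finset (Sym2 V)} (hM : IsMaximumAvoiding G S M) {u v w : V} (huv : u ≠ v)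
    (hu : Misses M u) (hv : Misses M v) (hw : ∃ N, IsMaximumAvoiding G S N ∧ Misses N w) :
    ∃ N, IsMaximumAvoiding G S N ∧ Misses N w ∧ (Misses N u ∨ Misses N v) := by
  classical
  by_contra! hcon
  obtain ⟨N₀, hN₀, hwN₀⟩ := hw
  refine not_of_exists_inter_card_lt M (P := fun N => IsMaximumAvoiding G S N ∧ Misses N w)
    ?_ N₀ ⟨hN₀, hwN₀⟩
  rintro N ⟨hN, hwN⟩
  obtain ⟨huN, hvN⟩ := hcon N hN hwN
  have hcard : M.card = N.card :=
    le_antisymm (hN.2.2 M hM.1 hM.2.1) (hM.2.2 N hN.1 hN.2.1)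
  have hm := hM.1.card_missed
  have hn := hN.1.card_missed
  set m := Finset.univ.filter (Misses M)
  set n := Finset.univ.filter (Misses N)
  have htwo : 1 < (m \ n).card :=
    Finset.one_lt_card.2 ⟨u, by simp [m, n, hu, huN], v, by simp [m, n, hv, hvN], huv⟩
  have h₁ := Finset.card_sdiff_add_card_inter m n
  have h₂ := Finset.card_sdiff_add_card_inter n m
  rw [Finset.inter_comm] at h₂
  obtain ⟨x, hx, hxw⟩ := Finset.exists_mem_ne (s := n \ m) (by omega) w
  obtain ⟨hxN, hxM⟩ : Misses N x ∧ ¬ Misses M x := by simpa [m, n] using hx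
  obtain ⟨y, hxy, hyN | ⟨N', hN', hc, hpres, hlt⟩⟩ := hM.1.exists_exchange hN.1 hxM hxN
  · obtain ⟨hins, hc⟩ := hN.1.insert (hM.1.adj hxy) hxN hyN
    have := hN.2.2 _ hins fun s hs => (hN.2.1 s hs).insert
      (by rintro rfl; exact hM.2.1 _ hs _ hxy (Sym2.mem_mk_left _ _))
      (by rintro rfl; exact hM.2.1 _ hs _ hxy (Sym2.mem_mk_right _ _))
    omega
  · refine ⟨N', ⟨⟨hN', fun s hs => hpres s ?_ (hN.2.1 s hs), ?_⟩, hpres w hxw.symm hwN⟩, hlt⟩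
    · rintro rfl
      exact hxM (hM.2.1 _ hs)
    · rw [hc]
      exact hN.2.2

open scoped Classical in
/-- The edges of `M` with no endpoint in `S`. -/
noncomputable def edgesAvoiding {V : Type*} (M : Finset (Sym2 V)) (S : Finset V) :
    Finset (Sym2 V) :=
  M.filter fun e => ∀ v ∈ S, v ∉ e

lemma mem_edgesAvoiding {V : Type*} {M : Finset (Sym2 V)} {S : Finset V} {e : Sym2 V} :
    e ∈ edgesAvoiding M S ↔ e ∈ M ∧ ∀ v ∈ S, v ∉ e := by
  simp [edgesAvoiding]

lemma edgesAvoiding_subset {V : Type*} (M : Finset (Sym2 V)) (S : Finset V) :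
    edgesAvoiding M S ⊆ M :=
  fun _ he => (mem_edgesAvoiding.1 he).1

lemma misses_edgesAvoiding {V : Type*} {M : Finset (Sym2 V)} {S : Finset V} {v : V} (hv : v ∈ S) :
    Misses (edgesAvoiding M S) v :=
  fun _ he => (mem_edgesAvoiding.1 he).2 v hv

lemma IsMatchingFinset.misses_edgesAvoiding_of_mem {V : Type*} {G : SimpleGraph V}
    {M : Finset (Sym2 V)} (hM : IsMatchingFinset G M) {S : Finset V} {a b : V} (ha : a ∈ S)
    (hab : s(a, b) ∈ M) : Misses (edgesAvoiding M S) b := by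
  intro e he hbe
  have := hM.eq_of_mem (edgesAvoiding_subset M S he) hab hbe (Sym2.mem_mk_right a b)
  exact (mem_edgesAvoiding.1 he).2 a ha (this ▸ Sym2.mem_mk_left a b)

lemma IsMatchingFinset.card_le_card_edgesAvoiding {V : Type*} {G : SimpleGraph V}
    {M : Finset (Sym2 V)} (hM : IsMatchingFinset G M) {S T : Finset V}
    (hT : ∀ e ∈ M, ∀ v ∈ S, v ∈ e → ∃ w ∈ T, w ∈ e) :
    M.card ≤ (edgesAvoiding M S).card + T.card := by
  classical
  have hsub : M ⊆ edgesAvoiding M S ∪ T.biUnion fun t => M.filter fun e => t ∈ e := by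
    intro e he
    by_cases h : ∀ v ∈ S, v ∉ e
    · exact Finset.mem_union_left _ (mem_edgesAvoiding.2 ⟨he, h⟩)
    · push Not at h
      obtain ⟨v, hv, hve⟩ := h
      obtain ⟨w, hw, hwe⟩ := hT e he v hv hve
      exact Finset.mem_union_right _
        (Finset.mem_biUnion.2 ⟨w, hw, Finset.mem_filter.2 ⟨he, hwe⟩⟩)
  have hbi : (T.biUnion fun t => M.filter fun e => t ∈ e).card ≤ T.card * 1 := by
    refine Finset.card_biUnion_le_card_mul _ _ _ fun t _ => Finset.card_le_one.2 ?_
    intro e he f hf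
    rw [Finset.mem_filter] at he hf
    exact hM.eq_of_mem he.1 hf.1 he.2 hf.2
  have := (Finset.card_le_card hsub).trans (Finset.card_union_le _ _)
  omega

/-- Removing vertices of `A(G)` one by one lowers the matching number each time and creates no
new missed vertices (the stability lemma). -/
lemma IsMaximumMatchingFinset.stability {V : Type*} [Fintype V] {G : SimpleGraph V}
    {M : Finset (Sym2 V)} (hM : IsMaximumMatchingFinset G M) (S : Finset V)
    (hS : ∀ a ∈ S, a ∈ gallaiA G) :
    (∀ L, IsMatchingFinset G L → (∀ a ∈ S, Misses L a) → L.card + S.card ≤ M.card) ∧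
    ∀ L, IsMatchingFinset G L → (∀ a ∈ S, Misses L a) → L.card + S.card = M.card →
      ∀ v ∉ S, Misses L v → v ∈ gallaiD G := by
  classical
  induction S using Finset.induction_on with
  | empty =>
    refine ⟨fun L hL _ => hM.2 L hL, fun L hL _ hc v _ hv => ⟨L, ⟨hL, fun T hT => ?_⟩, hv⟩⟩
    rw [Finset.card_empty, add_zero] at hc
    exact hc ▸ hM.2 T hT
  | insert a S haS ih =>
    obtain ⟨ih₁, ih₂⟩ := ih fun b hb => hS b (Finset.mem_insert_of_mem hb)
    obtain ⟨haD, d, hdD, had⟩ := hS a (Finset.mem_insert_self a S)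
    have hlt : ∀ L, IsMatchingFinset G L → (∀ b ∈ S, Misses L b) → Misses L a →
        L.card + S.card < M.card := fun L hL hLS hLa =>
      lt_of_le_of_ne (ih₁ L hL hLS) fun hc => haD (ih₂ L hL hLS hc a haS hLa)
    rw [Finset.card_insert_of_notMem haS]
    refine ⟨fun L hL hLS => hlt L hL (fun b hb => hLS b (Finset.mem_insert_of_mem hb))
      (hLS a (Finset.mem_insert_self a S)), ?_⟩
    intro L₀ hL₀ hL₀S hL₀c v hv hL₀v
    by_contra hvD
    have hdv : v ≠ d := fun h => hvD (h ▸ hdD)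
    rw [Finset.mem_insert, not_or] at hv
    obtain ⟨hva, hvS⟩ := hv
    have hdS : d ∉ S := fun h => (hS d (Finset.mem_insert_of_mem h)).1 hdD
    obtain ⟨N₀, hN₀, hdN₀⟩ := hdD
    obtain ⟨N, hN, hNS, hNd, hNc⟩ : ∃ N, IsMatchingFinset G N ∧ (∀ b ∈ S, Misses N b) ∧
        Misses N d ∧ N.card + S.card = M.card := by
      have hsub := edgesAvoiding_subset N₀ S
      have h₁ := ih₁ _ (hN₀.1.subset hsub) fun b hb => misses_edgesAvoiding hb
      have h₂ := hN₀.1.card_le_card_edgesAvoiding (S := S) (T := S)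
        fun e _ v hv hve => ⟨v, hv, hve⟩
      have h₃ := hN₀.2 M hM.1
      exact ⟨_, hN₀.1.subset hsub, fun b hb => misses_edgesAvoiding hb,
        Misses.subset hdN₀ hsub, by omega⟩
    have hNa : ¬ Misses N a := fun h => haD (ih₂ N hN hNS hNc a haS h)
    have hNv : ¬ Misses N v := fun h => hvD (ih₂ N hN hNS hNc v hvS h)
    refine not_of_exists_inter_card_lt N (P := fun L => IsMatchingFinset G L ∧
      (∀ b ∈ S, Misses L b) ∧ Misses L a ∧ Misses L v ∧ L.card + S.card + 1 = M.card) ?_ L₀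
      ⟨hL₀, fun b hb => hL₀S b (Finset.mem_insert_of_mem hb),
        hL₀S a (Finset.mem_insert_self a S), hL₀v, by omega⟩
    rintro L ⟨hL, hLS, hLa, hLv, hLc⟩
    have hLd : ¬ Misses L d := by
      intro hLd
      obtain ⟨hins, hc⟩ := hL.insert had hLa hLd
      refine hvD (ih₂ _ hins (fun b hb => (hLS b hb).insert ?_ ?_) (by omega) v hvS
        (hLv.insert hva hdv))
      · rintro rfl
        exact haS hb
      · rintro rfl
        exact hdS hb
    have hl := hL.card_missed
    have hn := hN.card_missed
    obtain ⟨x, hxL, hxN, hxa, hxv⟩ :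
        ∃ x, Misses L x ∧ ¬ Misses N x ∧ x ≠ a ∧ x ≠ v := by
      set l := Finset.univ.filter (Misses L)
      set n := Finset.univ.filter (Misses N)
      have hone : 0 < (n \ l).card := Finset.card_pos.2 ⟨d, by simp [l, n, hNd, hLd]⟩
      have h₁ := Finset.card_sdiff_add_card_inter l n
      have h₂ := Finset.card_sdiff_add_card_inter n l
      rw [Finset.inter_comm] at h₂
      obtain ⟨x, hx, hxav⟩ := Finset.exists_mem_notMem_of_card_lt_card
        (s := {a, v}) (t := l \ n) (by have := Finset.card_le_two (a := a) (b := v); omega)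
      obtain ⟨h₃, h₄⟩ : Misses L x ∧ ¬ Misses N x := by simpa [l, n] using hx
      simp only [Finset.mem_insert, Finset.mem_singleton, not_or] at hxav
      exact ⟨x, h₃, h₄, hxav⟩
    have hS_ne : ∀ {b y z}, b ∈ S → s(y, z) ∈ N → b ≠ y ∧ b ≠ z := by
      rintro b y z hb hyz
      constructor <;> rintro rfl
      exacts [hNS _ hb _ hyz (Sym2.mem_mk_left _ _), hNS _ hb _ hyz (Sym2.mem_mk_right _ _)]
    obtain ⟨y, hxy, hyL | ⟨L', hL', hc, hpres, hlt'⟩⟩ := hN.exists_exchange hL hxN hxL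
    · exfalso
      obtain ⟨hins, hc⟩ := hL.insert (hN.adj hxy) hxL hyL
      have hinsS : ∀ b ∈ S, Misses (insert s(x, y) L) b := fun b hb =>
        (hLS b hb).insert (hS_ne hb hxy).1 (hS_ne hb hxy).2
      by_cases hya : a = y
      · subst hya
        exact hvD (ih₂ _ hins hinsS (by omega) v hvS (hLv.insert hxv.symm hva))
      · have := hlt _ hins hinsS (hLa.insert hxa.symm hya)
        omega
    · exact ⟨L', ⟨hL', fun b hb => hpres b (hS_ne hb hxy).1 (hLS b hb), hpres a hxa.symm hLa,
        hpres v hxv.symm hLv, by omega⟩, hlt'⟩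

open scoped Classical in
/-- `A(G)` as a finset. -/
noncomputable def gallaiAFinset {V : Type*} [Fintype V] (G : SimpleGraph V) : Finset V :=
  Finset.univ.filter (· ∈ gallaiA G)

lemma mem_gallaiAFinset {V : Type*} [Fintype V] {G : SimpleGraph V} {v : V} :
    v ∈ gallaiAFinset G ↔ v ∈ gallaiA G := by
  simp [gallaiAFinset]

lemma mem_compSupp {V : Type*} {G : SimpleGraph V}
    {c : (G.induce (gallaiD G)).ConnectedComponent} {v : V} :
    v ∈ compSupp G c ↔
      ∃ h : v ∈ gallaiD G, (G.induce (gallaiD G)).connectedComponentMk ⟨v, h⟩ = c := by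
  simp [compSupp]

lemma mem_compSupp_of_adj {V : Type*} {G : SimpleGraph V}
    {c : (G.induce (gallaiD G)).ConnectedComponent} {v w : V}
    (hv : v ∈ compSupp G c) (hvw : G.Adj v w) (hw : w ∉ gallaiA G) : w ∈ compSupp G c := by
  obtain ⟨hvD, rfl⟩ := mem_compSupp.1 hv
  have hwD : w ∈ gallaiD G := by
    by_contra hwD
    exact hw ⟨hwD, v, hvD, hvw.symm⟩
  refine mem_compSupp.2 ⟨hwD, SimpleGraph.ConnectedComponent.sound ?_⟩
  exact (SimpleGraph.induce_adj.2 hvw.symm : (G.induce (gallaiD G)).Adj ⟨w, hwD⟩ ⟨v, hvD⟩).reachable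

section GallaiA

variable {V : Type*} [Fintype V] {G : SimpleGraph V} {M : Finset (Sym2 V)}

lemma IsMaximumMatchingFinset.card_edgesAvoiding (hM : IsMaximumMatchingFinset G M) :
    (edgesAvoiding M (gallaiAFinset G)).card + (gallaiAFinset G).card = M.card := by
  refine le_antisymm ?_ (hM.1.card_le_card_edgesAvoiding fun e _ v hv hve => ⟨v, hv, hve⟩)
  exact (hM.stability (gallaiAFinset G) fun _ => mem_gallaiAFinset.1).1 _
    (hM.1.subset (edgesAvoiding_subset _ _)) fun a ha => misses_edgesAvoiding ha

lemma IsMaximumMatchingFinset.edgesAvoiding (hM : IsMaximumMatchingFinset G M) :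
    IsMaximumAvoiding G (gallaiAFinset G) (edgesAvoiding M (gallaiAFinset G)) := by
  refine ⟨hM.1.subset (edgesAvoiding_subset _ _), fun a ha => misses_edgesAvoiding ha, ?_⟩
  intro T hT hTS
  have h₁ := (hM.stability (gallaiAFinset G) fun _ => mem_gallaiAFinset.1).1 T hT hTS
  have h₂ := hM.card_edgesAvoiding
  omega

lemma IsMaximumMatchingFinset.mem_gallaiD_of_misses (hM : IsMaximumMatchingFinset G M) {v : V}
    (hv : v ∉ gallaiA G) (h : Misses (_root_.edgesAvoiding M (gallaiAFinset G)) v) :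
    v ∈ gallaiD G :=
  (hM.stability (gallaiAFinset G) fun _ => mem_gallaiAFinset.1).2 _ hM.edgesAvoiding.1
    hM.edgesAvoiding.2.1 hM.card_edgesAvoiding v (mem_gallaiAFinset.not.2 hv) h

lemma IsMaximumMatchingFinset.mem_gallaiD_of_mem_gallaiA (hM : IsMaximumMatchingFinset G M)
    {a b : V} (ha : a ∈ gallaiA G) (hab : s(a, b) ∈ M) : b ∈ gallaiD G := by
  classical
  rw [← mem_gallaiAFinset] at ha
  refine hM.mem_gallaiD_of_misses (fun hb => ?_) (hM.1.misses_edgesAvoiding_of_mem ha hab)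
  rw [← mem_gallaiAFinset] at hb
  have h₁ := hM.1.card_le_card_edgesAvoiding (S := gallaiAFinset G)
    (T := (gallaiAFinset G).erase b) fun e he v hv hve => by
      by_cases hvb : v = b
      · subst hvb
        refine ⟨a, Finset.mem_erase.2 ⟨(hM.1.adj hab).ne, ha⟩, ?_⟩
        rw [hM.1.eq_of_mem he hab hve (Sym2.mem_mk_right a v)]
        exact Sym2.mem_mk_left a v
      · exact ⟨v, Finset.mem_erase.2 ⟨hvb, hv⟩, hve⟩
  have h₂ := hM.card_edgesAvoiding
  have h₃ := Finset.card_erase_lt_of_mem hb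
  omega

lemma exists_isMaximumAvoiding_misses {v : V} (hv : v ∈ gallaiD G) :
    ∃ N, IsMaximumAvoiding G (gallaiAFinset G) N ∧ Misses N v := by
  obtain ⟨N, hN, hvN⟩ := hv
  exact ⟨_, IsMaximumMatchingFinset.edgesAvoiding hN,
    Misses.subset hvN (edgesAvoiding_subset _ _)⟩

lemma IsMaximumAvoiding.eq_of_reachable (hM : IsMaximumAvoiding G (gallaiAFinset G) M)
    {u v : gallaiD G} (huv : (G.induce (gallaiD G)).Reachable u v) (hu : Misses M u)
    (hv : Misses M v) : u = v := by
  classical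
  obtain ⟨p⟩ := huv
  induction p generalizing M with
  | nil => rfl
  | @cons u w v h p ih =>
    by_contra hne
    obtain ⟨N, hN, hw, h' | h'⟩ := hM.exists_misses_and_misses (fun h => hne (Subtype.ext h)) hu hv
      (exists_isMaximumAvoiding_misses w.2)
    · obtain ⟨hins, hc⟩ := hN.1.insert (SimpleGraph.induce_adj.1 h) h' hw
      have := hN.2.2 _ hins fun s hs => (hN.2.1 s hs).insert
        (by rintro rfl; exact (mem_gallaiAFinset.1 hs).1 u.2)
        (by rintro rfl; exact (mem_gallaiAFinset.1 hs).1 w.2)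
      omega
    · obtain rfl := ih hN hw h'
      obtain ⟨hins, hc⟩ := hM.1.insert (SimpleGraph.induce_adj.1 h) hu hv
      have := hM.2.2 _ hins fun s hs => (hM.2.1 s hs).insert
        (by rintro rfl; exact (mem_gallaiAFinset.1 hs).1 u.2)
        (by rintro rfl; exact (mem_gallaiAFinset.1 hs).1 w.2)
      omega

lemma IsMatchingFinset.subset_compSupp (hM : IsMatchingFinset G M)
    (hMA : ∀ a ∈ gallaiAFinset G, Misses M a)
    {c : (G.induce (gallaiD G)).ConnectedComponent} {v : V} (hv : v ∈ compSupp G c) {e : Sym2 V}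
    (he : e ∈ M) (hve : v ∈ e) : ∀ u ∈ e, u ∈ compSupp G c := by
  obtain ⟨w, rfl⟩ := hve
  intro u hu
  rcases Sym2.mem_iff.1 hu with rfl | rfl
  · exact hv
  · exact mem_compSupp_of_adj hv (hM.adj he) fun hw =>
      hMA _ (mem_gallaiAFinset.2 hw) _ he hu

open scoped Classical in
lemma IsMatchingFinset.even_card_covered_compSupp (hM : IsMatchingFinset G M)
    (hMA : ∀ a ∈ gallaiAFinset G, Misses M a) (c : (G.induce (gallaiD G)).ConnectedComponent) :
    Even (Finset.univ.filter fun v => v ∈ compSupp G c ∧ ¬ Misses M v).card := by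
  have hK := hM.subset (Finset.filter_subset (fun e => ∀ u ∈ e, u ∈ compSupp G c) M)
  have h : (Finset.univ.filter fun v => v ∈ compSupp G c ∧ ¬ Misses M v) =
      Finset.univ.filter fun v =>
        ¬ Misses (M.filter fun e => ∀ u ∈ e, u ∈ compSupp G c) v := by
    ext v
    simp only [Misses, Finset.mem_filter, Finset.mem_univ, true_and, not_forall, not_not]
    constructor
    · rintro ⟨hv, e, he, hve⟩
      exact ⟨e, ⟨he, hM.subset_compSupp hMA hv he hve⟩, hve⟩
    · rintro ⟨e, ⟨he, hec⟩, hve⟩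
      exact ⟨hec v hve, e, he, hve⟩
  rw [h, hK.card_covered]
  exact even_two_mul _

lemma IsMaximumAvoiding.exists_misses_mem_compSupp
    (hM : IsMaximumAvoiding G (gallaiAFinset G) M)
    (c : (G.induce (gallaiD G)).ConnectedComponent) : ∃ v ∈ compSupp G c, Misses M v := by
  classical
  by_contra! hcon
  obtain ⟨⟨k, hkD⟩, rfl⟩ := c.exists_rep
  set c := (G.induce (gallaiD G)).connectedComponentMk ⟨k, hkD⟩
  have hkc : k ∈ compSupp G c := mem_compSupp.2 ⟨hkD, rfl⟩
  obtain ⟨N, hN, hkN⟩ := exists_isMaximumAvoiding_misses hkD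
  have hMe := hM.1.even_card_covered_compSupp hM.2.1 c
  have hNe := hN.1.even_card_covered_compSupp hN.2.1 c
  have h : (Finset.univ.filter fun v => v ∈ compSupp G c ∧ ¬ Misses M v) =
      insert k (Finset.univ.filter fun v => v ∈ compSupp G c ∧ ¬ Misses N v) := by
    ext v
    simp only [Finset.mem_filter, Finset.mem_univ, true_and, Finset.mem_insert]
    constructor
    · rintro ⟨hv, -⟩
      refine or_iff_not_imp_right.2 fun h => ?_
      obtain ⟨hvD, hvc⟩ := mem_compSupp.1 hv
      exact congrArg Subtype.val (hN.eq_of_reachable (u := ⟨v, hvD⟩) (v := ⟨k, hkD⟩)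
        (SimpleGraph.ConnectedComponent.exact hvc) (not_not.1 fun h' => h ⟨hv, h'⟩) hkN)
    · rintro (rfl | ⟨hv, -⟩)
      exacts [⟨hkc, hcon _ hkc⟩, ⟨hv, hcon _ hv⟩]
  rw [h, Finset.card_insert_of_notMem (by simp [hkN]), Nat.even_add_one] at hMe
  exact hMe hNe

lemma IsMaximumMatchingFinset.misses_edgesAvoiding_iff (hM : IsMaximumMatchingFinset G M)
    {c : (G.induce (gallaiD G)).ConnectedComponent} {v : V} (hv : v ∈ compSupp G c) :
    Misses (_root_.edgesAvoiding M (gallaiAFinset G)) v ↔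
      ∀ e ∈ M, (∀ u, u ∈ e → u ∈ compSupp G c) → v ∉ e := by
  constructor
  · intro h e he hec
    refine h e (mem_edgesAvoiding.2 ⟨he, fun a ha hae => ?_⟩)
    exact (mem_gallaiAFinset.1 ha).1 (mem_compSupp.1 (hec a hae)).1
  · intro h e he hve
    exact h e (edgesAvoiding_subset _ _ he)
      (hM.edgesAvoiding.1.subset_compSupp hM.edgesAvoiding.2.1 hv he hve) hve

end GallaiA

/-- Gallai–Edmonds (d): every maximum matching `M` of `G` contains a near-perfect matching
of each connected component of the subgraph induced by `D(G)` (its edges inside the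
component cover all but exactly one of its vertices), contains a perfect matching of the
subgraph induced by `C(G)`, and matches every vertex of `A(G)` to vertices lying in
pairwise distinct components of the subgraph induced by `D(G)`. -/
theorem gallai_edmonds_d {V : Type*} [Fintype V] (G : SimpleGraph V)
    (M : Finset (Sym2 V)) (hM : IsMaximumMatchingFinset G M) :
    (∀ c : (G.induce (gallaiD G)).ConnectedComponent,
      ∃! v : V, v ∈ compSupp G c ∧
        ∀ e ∈ M, (∀ u, u ∈ e → u ∈ compSupp G c) → v ∉ e) ∧
    (∀ v ∈ gallaiC G, ∃ e ∈ M, v ∈ e ∧ ∀ u, u ∈ e → u ∈ gallaiC G) ∧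
    (∀ a ∈ gallaiA G, ∃ b ∈ gallaiD G, s(a, b) ∈ M) ∧
    (∀ a a' b b' : V, a ∈ gallaiA G → a' ∈ gallaiA G → a ≠ a' →
      ∀ (hb : b ∈ gallaiD G) (hb' : b' ∈ gallaiD G),
        s(a, b) ∈ M → s(a', b') ∈ M →
        ¬ (G.induce (gallaiD G)).Reachable ⟨b, hb⟩ ⟨b', hb'⟩) := by
  have hcov : ∀ v ∉ gallaiD G, ∃ w, s(v, w) ∈ M := fun v hv =>
    exists_mem_of_not_misses fun h => hv ⟨M, hM, h⟩
  refine ⟨fun c => ?_, fun v hv => ?_, fun a ha => ?_, ?_⟩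
  · obtain ⟨v, hv, hvM⟩ := hM.edgesAvoiding.exists_misses_mem_compSupp c
    refine ⟨v, ⟨hv, (hM.misses_edgesAvoiding_iff hv).1 hvM⟩, ?_⟩
    rintro w ⟨hw, hwM⟩
    obtain ⟨hvD, hvc⟩ := mem_compSupp.1 hv
    obtain ⟨hwD, hwc⟩ := mem_compSupp.1 hw
    exact congrArg Subtype.val (hM.edgesAvoiding.eq_of_reachable (u := ⟨w, hwD⟩) (v := ⟨v, hvD⟩)
      (SimpleGraph.ConnectedComponent.exact (hwc.trans hvc.symm))
      ((hM.misses_edgesAvoiding_iff hw).2 hwM) hvM)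
  · obtain ⟨w, hw⟩ := hcov v hv.1
    refine ⟨_, hw, Sym2.mem_mk_left v w, fun u hu => ?_⟩
    rcases Sym2.mem_iff.1 hu with rfl | rfl
    · exact hv
    · exact ⟨fun huD => hv.2 ⟨hv.1, u, huD, hM.1.adj hw⟩, fun huA =>
        hv.1 (hM.mem_gallaiD_of_mem_gallaiA huA (Sym2.eq_swap ▸ hw))⟩
  · obtain ⟨b, hb⟩ := hcov a ha.1
    exact ⟨b, hM.mem_gallaiD_of_mem_gallaiA ha hb, hb⟩
  · intro a a' b b' ha ha' hne hb hb' hab hab' hreach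
    have h := hM.edgesAvoiding.eq_of_reachable hreach
      (hM.1.misses_edgesAvoiding_of_mem (mem_gallaiAFinset.2 ha) hab)
      (hM.1.misses_edgesAvoiding_of_mem (mem_gallaiAFinset.2 ha') hab')
    obtain rfl : b = b' := congrArg Subtype.val h
    have := hM.1.eq_of_mem hab hab' (Sym2.mem_mk_right _ _) (Sym2.mem_mk_right _ _)
    exact hne (Sym2.congr_left.1 this)
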